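/- For every n ≥ 1 and t > 0, −2(−1)^n t r_n(t) = β_n(t) R_n(t) R_{n−1}(t). -/

import Mathlib

open MeasureTheory Polynomial

/-- The singularly perturbed Gaussian weight `w(x,t) = exp(-x^2 - t/x^2)` for `x ≠ 0`,
extended by `0` at `x = 0`. -/
noncomputable def w (t x : ℝ) : ℝ := if x = 0 then 0 else Real.exp (-x ^ 2 - t / x ^ 2)

lemma w_neg (t x : ℝ) : w t (-x) = w t x := by
  simp [w]

lemma measurable_w (t : ℝ) : Measurable (w t) := by
  unfold w
  exact Measurable.ite (measurableSet_singleton 0) measurable_const (by fun_prop)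

/-- The factor `exp (-t / x ^ 2)` absorbs the singularity `x⁻³`. -/
lemma abs_w_div_cube_le {t : ℝ} (ht : 0 < t) (x : ℝ) :
    |w t x / x ^ 3| ≤ (1 + 2 / t ^ 2) * Real.exp (-x ^ 2) := by
  rcases eq_or_ne x 0 with rfl | hx
  · simp only [w, if_true, zero_div, abs_zero]
    positivity
  have hx' : 0 < |x| := abs_pos.mpr hx
  have hw : |w t x / x ^ 3| = Real.exp (-x ^ 2) * (Real.exp (-(t / x ^ 2)) * (|x| ^ 3)⁻¹) := by
    rw [w, if_neg hx, abs_div, Real.abs_exp, abs_pow, sub_eq_add_neg, Real.exp_add]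
    ring
  rw [hw, mul_comm (1 + _)]
  refine mul_le_mul_of_nonneg_left ?_ (Real.exp_pos _).le
  have hexp_le : Real.exp (-(t / x ^ 2)) ≤ 1 := Real.exp_le_one_iff.mpr (by
    have : 0 ≤ t / x ^ 2 := by positivity
    linarith)
  have hquad : (t / x ^ 2) ^ 2 / 2 * Real.exp (-(t / x ^ 2)) ≤ 1 := by
    have h1 := Real.quadratic_le_exp_of_nonneg (x := t / x ^ 2) (by positivity)
    have h2 : 0 ≤ t / x ^ 2 := by positivity
    rw [Real.exp_neg, ← div_eq_mul_inv, div_le_one (Real.exp_pos _)]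
    linarith
  have hfour : Real.exp (-(t / x ^ 2)) * (|x| ^ 4)⁻¹ ≤ 2 / t ^ 2 := by
    have h4 : |x| ^ 4 = x ^ 4 := by rw [show 4 = 2 * 2 by rfl, pow_mul, sq_abs, pow_mul]
    rw [h4]
    calc Real.exp (-(t / x ^ 2)) * (x ^ 4)⁻¹
        = ((t / x ^ 2) ^ 2 / 2 * Real.exp (-(t / x ^ 2))) * (2 / t ^ 2) := by
          field_simp
      _ ≤ 1 * (2 / t ^ 2) := mul_le_mul_of_nonneg_right hquad (by positivity)
      _ = 2 / t ^ 2 := one_mul _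
  have hcube : (|x| ^ 3)⁻¹ ≤ 1 + (|x| ^ 4)⁻¹ := by
    have hi : 0 < |x|⁻¹ := inv_pos.mpr hx'
    rw [← inv_pow, ← inv_pow]
    rcases le_total (|x|⁻¹) 1 with h1 | h1
    · have := pow_le_one₀ hi.le h1 (n := 3)
      have := pow_pos hi 4
      linarith
    · have := pow_le_pow_right₀ h1 (show 3 ≤ 4 by norm_num)
      linarith
  calc Real.exp (-(t / x ^ 2)) * (|x| ^ 3)⁻¹
      ≤ Real.exp (-(t / x ^ 2)) * (1 + (|x| ^ 4)⁻¹) :=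
        mul_le_mul_of_nonneg_left hcube (Real.exp_pos _).le
    _ ≤ 1 + 2 / t ^ 2 := by
        rw [mul_add, mul_one]
        exact add_le_add hexp_le hfour

lemma integrable_eval_mul_exp_neg_sq (f : ℝ[X]) :
    Integrable fun x : ℝ => f.eval x * Real.exp (-x ^ 2) := by
  induction f using Polynomial.induction_on' with
  | add p q hp hq =>
    refine (hp.add hq).congr (.of_forall fun x => ?_)
    simp [add_mul]
  | monomial n a =>
    have h := integrable_rpow_mul_exp_neg_mul_sq (b := 1) one_pos (s := (n : ℝ))
      (by have : (0 : ℝ) ≤ n := n.cast_nonneg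
          linarith)
    refine (h.const_mul a).congr (.of_forall fun x => ?_)
    simp [mul_assoc]

lemma integrable_eval_mul_w_div_cube {t : ℝ} (ht : 0 < t) (f : ℝ[X]) :
    Integrable fun x : ℝ => f.eval x * (w t x / x ^ 3) := by
  refine ((integrable_eval_mul_exp_neg_sq f).norm.const_mul (1 + 2 / t ^ 2)).mono' ?_
    (.of_forall fun x => ?_)
  · exact (f.continuous.measurable.mul
      ((measurable_w t).div (measurable_id.pow_const 3))).aestronglyMeasurable
  · rw [norm_mul, norm_mul, Real.norm_eq_abs (w t x / x ^ 3), Real.norm_of_nonneg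
      (Real.exp_pos _).le, mul_left_comm]
    exact mul_le_mul_of_nonneg_left (abs_w_div_cube_le ht x) (norm_nonneg _)

/-- Integration of a polynomial against `w(x,t) / x ^ 3`. -/
noncomputable def cubeMoment {t : ℝ} (ht : 0 < t) : ℝ[X] →ₗ[ℝ] ℝ where
  toFun f := ∫ x : ℝ, f.eval x * (w t x / x ^ 3)
  map_add' f g := by
    simp only [eval_add, add_mul]
    exact integral_add (integrable_eval_mul_w_div_cube ht f) (integrable_eval_mul_w_div_cube ht g)
  map_smul' c f := by
    simp only [eval_smul, smul_eq_mul, mul_assoc, RingHom.id_apply]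
    exact integral_const_mul _ _

lemma cubeMoment_apply {t : ℝ} (ht : 0 < t) (f : ℝ[X]) :
    cubeMoment ht f = ∫ x : ℝ, f.eval x * (w t x / x ^ 3) := rfl

lemma cubeMoment_comp_neg_X {t : ℝ} (ht : 0 < t) (f : ℝ[X]) :
    cubeMoment ht (f.comp (-X)) = -cubeMoment ht f := by
  simp only [cubeMoment_apply]
  rw [← integral_neg_eq_self, ← integral_neg]
  congr 1 with x
  simp only [eval_comp, eval_neg, eval_X, neg_neg, w_neg]
  rw [Odd.neg_pow (by decide), div_neg, mul_neg]

lemma coeff_comp_neg_X (f : ℝ[X]) (i : ℕ) : (f.comp (-X)).coeff i = (-1) ^ i * f.coeff i := by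
  have h : (-X : ℝ[X]) = C (-1) * X := by simp
  rw [h, comp_C_mul_X_coeff, mul_comm]

section Orthogonality

variable (Λ : ℝ[X] →ₗ[ℝ] ℝ) {P : ℕ → ℝ[X]} {h : ℕ → ℝ}

lemma coeff_self_of_monic {P : ℕ → ℝ[X]} (hmonic : ∀ n, (P n).Monic)
    (hdeg : ∀ n, (P n).natDegree = n) (n : ℕ) : (P n).coeff n = 1 := by
  have := (hmonic n).coeff_natDegree
  rwa [hdeg n] at this

lemma degree_sub_coeff_mul_lt (hmonic : ∀ n, (P n).Monic) (hdeg : ∀ n, (P n).natDegree = n)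
    {m : ℕ} {f : ℝ[X]} (hf : f.degree < (m + 1 : ℕ)) :
    (f - C (f.coeff m) * P m).degree < m := by
  rw [degree_lt_iff_coeff_zero] at hf ⊢
  intro i hi
  rw [coeff_sub, coeff_C_mul]
  rcases hi.eq_or_lt with rfl | hi
  · simp [coeff_self_of_monic hmonic hdeg]
  · rw [hf i hi, coeff_eq_zero_of_natDegree_lt ((hdeg m).trans_lt hi)]
    simp

lemma orthogonal_of_degree_lt (hmonic : ∀ n, (P n).Monic) (hdeg : ∀ n, (P n).natDegree = n)
    (horth : ∀ m n, m ≠ n → Λ (X ^ 3 * (P m * P n)) = 0) {n : ℕ} {f : ℝ[X]}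
    (hf : f.degree < n) : Λ (X ^ 3 * (P n * f)) = 0 := by
  have key : ∀ m ≤ n, ∀ f : ℝ[X], f.degree < m → Λ (X ^ 3 * (P n * f)) = 0 := by
    intro m
    induction m with
    | zero =>
      intro _ f hf
      have : f = 0 := by
        rw [← degree_eq_bot]
        exact Nat.WithBot.lt_zero_iff.mp (by simpa using hf)
      simp [this]
    | succ m ih =>
      intro hm f hf
      have h1 := ih (by omega) _ (degree_sub_coeff_mul_lt hmonic hdeg hf)
      have h2 : X ^ 3 * (P n * f) = X ^ 3 * (P n * (f - C (f.coeff m) * P m)) +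
          f.coeff m • (X ^ 3 * (P n * P m)) := by
        rw [smul_eq_C_mul]
        ring
      rw [h2, map_add, h1, map_smul, horth n m (by omega)]
      simp
  exact key n le_rfl f hf

lemma moment_mul_eq_coeff_mul (hmonic : ∀ n, (P n).Monic) (hdeg : ∀ n, (P n).natDegree = n)
    (horth : ∀ m n, m ≠ n → Λ (X ^ 3 * (P m * P n)) = 0)
    (hnorm : ∀ n, h n = Λ (X ^ 3 * (P n * P n))) {n : ℕ} {f : ℝ[X]}
    (hf : f.natDegree ≤ n) : Λ (X ^ 3 * (P n * f)) = f.coeff n * h n := by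
  have hf' : f.degree < (n + 1 : ℕ) :=
    (natDegree_le_iff_degree_le.mp hf).trans_lt (by exact_mod_cast n.lt_succ_self)
  have h1 := orthogonal_of_degree_lt Λ hmonic hdeg horth (degree_sub_coeff_mul_lt hmonic hdeg hf')
  have h2 : X ^ 3 * (P n * f) = X ^ 3 * (P n * (f - C (f.coeff n) * P n)) +
      f.coeff n • (X ^ 3 * (P n * P n)) := by
    rw [smul_eq_C_mul]
    ring
  rw [h2, map_add, h1, map_smul, ← hnorm]
  simp

/-- If the moment functional is even, then `P n` has the parity of `n`. -/
lemma comp_neg_X_eq (hmonic : ∀ n, (P n).Monic) (hdeg : ∀ n, (P n).natDegree = n)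
    (horth : ∀ m n, m ≠ n → Λ (X ^ 3 * (P m * P n)) = 0)
    (hnorm : ∀ n, h n = Λ (X ^ 3 * (P n * P n))) (hpos : ∀ n, 0 < h n)
    (hodd : ∀ f : ℝ[X], Λ (f.comp (-X)) = -Λ f) (n : ℕ) :
    (P n).comp (-X) = C ((-1) ^ n) * P n := by
  rw [← sub_eq_zero]
  by_contra hD
  set D := (P n).comp (-X) - C ((-1) ^ n) * P n with hDdef
  have hDdeg : D.degree < n := by
    rw [degree_lt_iff_coeff_zero]
    intro i hi
    rw [hDdef, coeff_sub, coeff_C_mul, coeff_comp_neg_X]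
    rcases hi.eq_or_lt with rfl | hi
    · simp
    · rw [coeff_eq_zero_of_natDegree_lt ((hdeg n).trans_lt hi)]
      simp
  have horthD : ∀ f : ℝ[X], f.degree < n → Λ (X ^ 3 * (D * f)) = 0 := by
    intro f hf
    have h1 := orthogonal_of_degree_lt Λ hmonic hdeg horth hf
    have h2 : Λ (X ^ 3 * (P n * f.comp (-X))) = 0 := by
      refine orthogonal_of_degree_lt Λ hmonic hdeg horth ?_
      rw [degree_lt_iff_coeff_zero] at hf ⊢
      intro i hi
      rw [coeff_comp_neg_X, hf i hi, mul_zero]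
    have h3 : X ^ 3 * (D * f) = -(X ^ 3 * (P n * f.comp (-X))).comp (-X) -
        (-1 : ℝ) ^ n • (X ^ 3 * (P n * f)) := by
      have h4 : (f.comp (-X)).comp (-X) = f := by
        rw [comp_assoc]
        simp
      rw [smul_eq_C_mul, mul_comp, mul_comp, h4, pow_comp, X_comp, hDdef]
      ring
    rw [h3, map_sub, map_neg, hodd, map_smul, h1, h2]
    simp
  have hlt : D.natDegree < n := (natDegree_lt_iff_degree_lt hD).mpr hDdeg
  have h1 := moment_mul_eq_coeff_mul Λ hmonic hdeg horth hnorm (le_refl D.natDegree)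
  have h2 := horthD (P D.natDegree) (by
    rw [degree_eq_natDegree (hmonic _).ne_zero, hdeg]
    exact_mod_cast hlt)
  rw [mul_comm D, h1] at h2
  rcases mul_eq_zero.mp h2 with h3 | h3
  · exact hD (leadingCoeff_eq_zero.mp h3)
  · exact (hpos _).ne' h3

lemma coeff_eq_zero_of_odd_add (hpar : ∀ n, (P n).comp (-X) = C ((-1) ^ n) * P n) {n i : ℕ}
    (hni : Odd (n + i)) : (P n).coeff i = 0 := by
  have h1 := congrArg (fun q => q.coeff i) (hpar n)
  simp only [coeff_comp_neg_X, coeff_C_mul] at h1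
  rcases Nat.even_or_odd n with hn | hn
  · have hi : Odd i := (Nat.odd_add'.mp hni).mpr hn
    rw [hi.neg_one_pow, hn.neg_one_pow] at h1
    linarith
  · have hi : Even i := (Nat.odd_add.mp hni).mp hn
    rw [hi.neg_one_pow, hn.neg_one_pow] at h1
    linarith

lemma eq_X_mul_divX_add (f : ℝ[X]) : f = X * f.divX + C (f.coeff 0) := by
  conv_lhs => rw [← divX_mul_X_add f]
  ring

/-- The key product formula for neighbouring orthogonal polynomials, `a` even and `b` odd. -/
lemma moment_product_formula (hmonic : ∀ n, (P n).Monic) (hdeg : ∀ n, (P n).natDegree = n)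
    (horth : ∀ m n, m ≠ n → Λ (X ^ 3 * (P m * P n)) = 0)
    (hnorm : ∀ n, h n = Λ (X ^ 3 * (P n * P n)))
    (hpar : ∀ n, (P n).comp (-X) = C ((-1) ^ n) * P n) {a b : ℕ} (ha : Even a) (hb : Odd b)
    (hab : a ≤ b + 1) (hba : b ≤ a + 1) :
    Λ (X * (P a * P a)) * Λ (X * (P b * P b)) =
      Λ (P a * P b) * ((P b).coeff (a + 1) * h a - (P a).coeff (b + 1) * h b) := by
  have hb1 : 1 ≤ b := hb.pos
  have hK := fun n f => moment_mul_eq_coeff_mul Λ hmonic hdeg horth hnorm (n := n) (f := f)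
  set E := (P a).divX.divX with hE
  set S := (P b).divX with hS
  set O := S.divX.divX with hO
  set p := (P a).coeff 0 with hp
  set q := (P b).coeff 1 with hq
  have hPa : P a = C p + X ^ 2 * E := by
    have h1 := eq_X_mul_divX_add (P a)
    have h2 := eq_X_mul_divX_add (P a).divX
    rw [coeff_divX, zero_add, coeff_eq_zero_of_odd_add hpar (ha.add_one), C_0, add_zero] at h2
    rw [h2] at h1
    rw [h1]
    ring
  have hPb : P b = X * S := by
    have h1 := eq_X_mul_divX_add (P b)
    rwa [coeff_eq_zero_of_odd_add hpar (show Odd (b + 0) from hb), C_0, add_zero] at h1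
  have hSO : S = C q + X ^ 2 * O := by
    have h1 := eq_X_mul_divX_add S
    have h2 := eq_X_mul_divX_add S.divX
    rw [coeff_divX, hS, coeff_divX, coeff_eq_zero_of_odd_add hpar (show Odd (b + (0 + 1 + 1)) by
      simpa using hb.add_even even_two), C_0, add_zero] at h2
    rw [hS, h2, coeff_divX] at h1
    rw [hS, h1]
    ring
  have hEdeg : E.natDegree = a - 2 := by
    rw [hE, natDegree_divX_eq_natDegree_tsub_one, natDegree_divX_eq_natDegree_tsub_one, hdeg]
    omega
  have hSdeg : S.natDegree = b - 1 := by
    rw [hS, natDegree_divX_eq_natDegree_tsub_one, hdeg]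
  have hOdeg : O.natDegree = b - 3 := by
    rw [hO, natDegree_divX_eq_natDegree_tsub_one, natDegree_divX_eq_natDegree_tsub_one, hSdeg]
    omega
  have hXE : X * E = (P a).divX := by
    have h2 := eq_X_mul_divX_add (P a).divX
    rw [coeff_divX, zero_add, coeff_eq_zero_of_odd_add hpar (ha.add_one), C_0, add_zero] at h2
    exact h2.symm
  have hO3 : ∀ i, O.coeff i = (P b).coeff (i + 3) := fun i => by
    rw [hO, coeff_divX, coeff_divX, hS, coeff_divX]
  have hEO : Λ (P a * P b) = q * Λ (X * P a) := by
    have h1 := hK a O (by omega)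
    have h2 : P a * P b = q • (X * P a) + X ^ 3 * (P a * O) := by
      rw [hPb, hSO, smul_eq_C_mul]
      ring
    rw [h2, map_add, map_smul, h1, hO3, coeff_eq_zero_of_natDegree_lt (by rw [hdeg]; omega)]
    simp
  have hEE : Λ (X * (P a * P a)) = p * Λ (X * P a) := by
    have h1 := hK a E (by omega)
    have h2 : X * (P a * P a) = p • (X * P a) + X ^ 3 * (P a * E) := by
      rw [smul_eq_C_mul]
      nth_rw 2 [hPa]
      ring
    rw [h2, map_add, map_smul, h1, hE, coeff_divX, coeff_divX,
      coeff_eq_zero_of_natDegree_lt (by rw [hdeg]; omega)]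
    simp
  have hOO : Λ (X * (P b * P b)) = q * Λ (X ^ 2 * P b) := by
    have h3 : (X * O).coeff b = 0 := by
      obtain ⟨c, rfl⟩ : ∃ c, b = c + 1 := ⟨b - 1, by omega⟩
      rw [coeff_X_mul, hO3, coeff_eq_zero_of_natDegree_lt (by rw [hdeg]; omega)]
    have h1 := hK b (X * O) (natDegree_mul_le.trans (by rw [natDegree_X]; omega))
    have h2 : X * (P b * P b) = q • (X ^ 2 * P b) + X ^ 3 * (P b * (X * O)) := by
      rw [smul_eq_C_mul]
      nth_rw 2 [hPb]
      rw [hSO]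
      ring
    rw [h2, map_add, map_smul, h1, h3]
    simp
  have hcross : p * Λ (X ^ 2 * P b) = (P b).coeff (a + 1) * h a - (P a).coeff (b + 1) * h b := by
    have h1 := hK b (X * E) (by
      rw [hXE, natDegree_divX_eq_natDegree_tsub_one, hdeg]
      omega)
    have h2 := hK a S (by omega)
    have h3 : p • (X ^ 2 * P b) = X ^ 3 * (P a * S) - X ^ 3 * (P b * (X * E)) := by
      rw [smul_eq_C_mul, hPb, hPa]
      ring
    rw [← smul_eq_mul, ← map_smul, h3, map_sub, h1, h2, hXE, hS, coeff_divX, coeff_divX]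
  rw [hEE, hOO, hEO, ← hcross]
  ring

lemma moment_product_succ (hmonic : ∀ n, (P n).Monic) (hdeg : ∀ n, (P n).natDegree = n)
    (horth : ∀ m n, m ≠ n → Λ (X ^ 3 * (P m * P n)) = 0)
    (hnorm : ∀ n, h n = Λ (X ^ 3 * (P n * P n)))
    (hpar : ∀ n, (P n).comp (-X) = C ((-1) ^ n) * P n) (m : ℕ) :
    Λ (X * (P (m + 1) * P (m + 1))) * Λ (X * (P m * P m)) =
      (-1) ^ m * h m * Λ (P (m + 1) * P m) := by
  have hlead := coeff_self_of_monic hmonic hdeg (m + 1)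
  have hzero : (P m).coeff (m + 1 + 1) = 0 :=
    coeff_eq_zero_of_natDegree_lt (by rw [hdeg]; omega)
  rcases Nat.even_or_odd m with hm | hm
  · have key := moment_product_formula Λ hmonic hdeg horth hnorm hpar hm hm.add_one
      (by omega) le_rfl
    rw [hlead, hzero] at key
    rw [hm.neg_one_pow, mul_comm, key, mul_comm (P m)]
    ring
  · have key := moment_product_formula Λ hmonic hdeg horth hnorm hpar hm.add_one hm
      le_rfl (by omega)
    rw [hlead, hzero] at key
    rw [hm.neg_one_pow, key]
    ring

end Orthogonality

theorem statement5
    (t : ℝ) (ht : 0 < t)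
    (P : ℕ → Polynomial ℝ)
    (hmonic : ∀ n, (P n).Monic)
    (hdeg : ∀ n, (P n).natDegree = n)
    (horth : ∀ m n : ℕ, m ≠ n → ∫ x : ℝ, (P m).eval x * (P n).eval x * w t x = 0)
    (h : ℕ → ℝ)
    (hh : ∀ n, h n = ∫ x : ℝ, ((P n).eval x) ^ 2 * w t x)
    (hhpos : ∀ n, 0 < h n)
    (R : ℕ → ℝ)
    (hR : ∀ n, R n = 2 * t / h n * ∫ y : ℝ, ((P n).eval y) ^ 2 / y ^ 2 * w t y)
    (r : ℕ → ℝ)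
    (hr : ∀ n, 1 ≤ n → r n = 2 * t / h (n - 1) *
      ∫ y : ℝ, (P n).eval y * (P (n - 1)).eval y / y ^ 3 * w t y)
    (β : ℕ → ℝ)
    (hβ : ∀ n, 1 ≤ n → β n = h n / h (n - 1))
    (n : ℕ) (hn : 1 ≤ n) :
    -2 * (-1 : ℝ) ^ n * t * r n = β n * R n * R (n - 1) := by
  obtain ⟨m, rfl⟩ : ∃ m, n = m + 1 := ⟨n - 1, by omega⟩
  set Λ := cubeMoment ht with hΛ
  have hzero : w t 0 = 0 := by simp [w]
  have hmom : ∀ f g : ℝ[X], Λ (X ^ 3 * (f * g)) = ∫ x : ℝ, f.eval x * g.eval x * w t x := by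
    intro f g
    rw [hΛ, cubeMoment_apply]
    congr 1 with x
    rcases eq_or_ne x 0 with rfl | hx
    · simp [hzero]
    · simp only [eval_mul, eval_pow, eval_X]
      field_simp
  have hmom2 : ∀ f : ℝ[X], Λ (X * (f * f)) = ∫ x : ℝ, (f.eval x) ^ 2 / x ^ 2 * w t x := by
    intro f
    rw [hΛ, cubeMoment_apply]
    congr 1 with x
    rcases eq_or_ne x 0 with rfl | hx
    · simp [hzero]
    · simp only [eval_mul, eval_X]
      field_simp
  have hmom3 : ∀ f g : ℝ[X], Λ (f * g) = ∫ x : ℝ, f.eval x * g.eval x / x ^ 3 * w t x := by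
    intro f g
    rw [hΛ, cubeMoment_apply]
    congr 1 with x
    rw [eval_mul]
    ring
  have horth' : ∀ m n, m ≠ n → Λ (X ^ 3 * (P m * P n)) = 0 := fun m n hmn => by
    rw [hmom, horth m n hmn]
  have hnorm : ∀ n, h n = Λ (X ^ 3 * (P n * P n)) := fun n => by
    rw [hh, hmom]
    simp only [sq]
  have hpar := comp_neg_X_eq Λ hmonic hdeg horth' hnorm hhpos (cubeMoment_comp_neg_X ht)
  have key := moment_product_succ Λ hmonic hdeg horth' hnorm hpar m
  rw [hr _ hn, hβ _ hn, hR, hR, Nat.add_sub_cancel, ← hmom2, ← hmom2, ← hmom3]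
  have h0 := (hhpos m).ne'
  have h1 := (hhpos (m + 1)).ne'
  calc -2 * (-1 : ℝ) ^ (m + 1) * t * (2 * t / h m * Λ (P (m + 1) * P m))
      = 4 * t ^ 2 / h m ^ 2 * ((-1) ^ m * h m * Λ (P (m + 1) * P m)) := by
        rw [pow_succ]
        field_simp
        ring
    _ = _ := by
        rw [← key]
        field_simp
        ring
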